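/- For every n ≥ 1, the number of isomorphism classes of minimally unsatisfiable 2-clause-sets of deficiency 1 with exactly n variables equals n(n+2)/4 if n is even, and (n+1)²/4 if n is odd. -/

import Mathlib

/-- A literal: a variable (a natural number) together with a polarity. -/
abbrev Lit : Type := ℕ × Bool

/-- Complementation of literals: a fixed-point-free involution. -/
def Lit.compl (x : Lit) : Lit := (x.1, !x.2)

/-- The set of variables occurring in a clause-set. -/
def varsOf (F : Finset (Finset Lit)) : Finset ℕ := F.biUnion (fun C => C.image Prod.fst)

/-- The literals over the variables of `F` (both polarities). -/
def litsOf (F : Finset (Finset Lit)) : Finset Lit := varsOf F ×ˢ (Finset.univ : Finset Bool)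

/-- A clause is clash-free. -/
def IsClause (C : Finset Lit) : Prop := ∀ x ∈ C, Lit.compl x ∉ C

/-- A clause-set consists of clauses. -/
def IsClauseSet (F : Finset (Finset Lit)) : Prop := ∀ C ∈ F, IsClause C

/-- The truth value of a literal under a total assignment. -/
def LitVal (φ : ℕ → Bool) (x : Lit) : Bool := if x.2 then φ x.1 else !(φ x.1)

/-- Satisfiability of a clause-set. -/
def Sat (F : Finset (Finset Lit)) : Prop := ∃ φ : ℕ → Bool, ∀ C ∈ F, ∃ x ∈ C, LitVal φ x = true

/-- Minimal unsatisfiability. -/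
def MU (F : Finset (Finset Lit)) : Prop := IsClauseSet F ∧ ¬ Sat F ∧ ∀ G ⊂ F, Sat G

/-- Minimally unsatisfiable 2-clause-set. -/
def MU2 (F : Finset (Finset Lit)) : Prop := MU F ∧ ∀ C ∈ F, C.card ≤ 2

/-- The deficiency δ(F) = c(F) - n(F). -/
def deficiency (F : Finset (Finset Lit)) : ℤ := (F.card : ℤ) - ((varsOf F).card : ℤ)

/-- Literal-degree: number of clauses containing the literal. -/
def ldeg (F : Finset (Finset Lit)) (x : Lit) : ℕ := (F.filter (fun C => x ∈ C)).card

/-- Variable-degree. -/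
def vdeg (F : Finset (Finset Lit)) (v : ℕ) : ℕ := ldeg F (v, true) + ldeg F (v, false)

/-- Isomorphism of clause-sets: a bijection between the literals over the variables,
commuting with complementation, mapping one clause-set onto the other. -/
def CNFIso (F F' : Finset (Finset Lit)) (f : Lit → Lit) : Prop :=
  Set.BijOn f ↑(litsOf F) ↑(litsOf F') ∧
  (∀ x ∈ litsOf F, f (Lit.compl x) = Lit.compl (f x)) ∧
  F.image (fun C => C.image f) = F'

/-- A digraph: a finite vertex set and a finite set of arcs. -/
structure FinDigraph (α : Type) where
  V : Finset α
  E : Finset (α × α)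

/-- Well-formedness of a digraph: arcs join distinct vertices. -/
def FinDigraph.WellFormed {α : Type} (G : FinDigraph α) : Prop :=
  ∀ p ∈ G.E, p.1 ∈ G.V ∧ p.2 ∈ G.V ∧ p.1 ≠ p.2

/-- `f` is an isomorphism of digraphs from `G` to `G'`. -/
def DigraphIso {α β : Type} [DecidableEq β] (G : FinDigraph α) (G' : FinDigraph β) (f : α → β) : Prop :=
  Set.BijOn f ↑G.V ↑G'.V ∧ G.E.image (fun p => (f p.1, f p.2)) = G'.E

/-- The implication digraph of a 2-clause-set (without the empty clause):
vertices are the literals over the variables of `F`, and there is an arc `(a,b)` iff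
`{compl a} ∪ {b}` is a clause of `F` (this yields `(x̄,y),(ȳ,x)` for a clause `{x,y}`
and `(x̄,x)` for a unit-clause `{x}`). -/
def idg (F : Finset (Finset Lit)) : FinDigraph Lit :=
  ⟨litsOf F, (litsOf F ×ˢ litsOf F).filter (fun p => insert (Lit.compl p.1) {p.2} ∈ F)⟩

def FinDigraph.inDeg {α : Type} [DecidableEq α] (G : FinDigraph α) (v : α) : ℕ :=
  (G.E.filter (fun p => p.2 = v)).card

def FinDigraph.outDeg {α : Type} [DecidableEq α] (G : FinDigraph α) (v : α) : ℕ :=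
  (G.E.filter (fun p => p.1 = v)).card

/-- The standard double `m`-cycle. -/
def stdDoubleCycle (m : ℕ) : FinDigraph ℕ :=
  ⟨Finset.range m, (Finset.range m).biUnion (fun i => {(i, (i+1) % m), ((i+1) % m, i)})⟩

/-- A double `m`-cycle (`m ≥ 3`). -/
def IsDoubleCycle {α : Type} [DecidableEq α] (m : ℕ) (G : FinDigraph α) : Prop :=
  3 ≤ m ∧ ∃ f : ℕ → α, DigraphIso (stdDoubleCycle m) G f

/-- Splitting a vertex `x` into `u`, `v` with a new arc `(u,v)`:
arcs into `x` now go into `u`, arcs out of `x` now leave `v`. -/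
def SplitVertex {α : Type} [DecidableEq α] (G G' : FinDigraph α) : Prop :=
  ∃ x u v, x ∈ G.V ∧ u ∉ G.V ∧ v ∉ G.V ∧ u ≠ v ∧
    G'.V = insert u (insert v (G.V.erase x)) ∧
    G'.E = insert (u, v)
      ((G.E.filter (fun p => p.1 ≠ x ∧ p.2 ≠ x)) ∪
       ((G.E.filter (fun p => p.2 = x)).image (fun p => (p.1, u))) ∪
       ((G.E.filter (fun p => p.1 = x)).image (fun p => (v, p.2))))

/-- Splitting an arc `(x,y)` by a new (linear) vertex `v`. -/
def SplitArc {α : Type} [DecidableEq α] (G G' : FinDigraph α) : Prop :=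
  ∃ x y v, (x, y) ∈ G.E ∧ v ∉ G.V ∧
    G'.V = insert v G.V ∧
    G'.E = insert (x, v) (insert (v, y) (G.E.erase (x, y)))

/-- An `m`-weak-double-cycle: obtained from a double `m`-cycle by a finite sequence
of vertex splittings and arc splittings. -/
def IsWDC {α : Type} [DecidableEq α] (m : ℕ) (G : FinDigraph α) : Prop :=
  ∃ G₀ : FinDigraph α, IsDoubleCycle m G₀ ∧
    Relation.ReflTransGen (fun A B => SplitVertex A B ∨ SplitArc A B) G₀ G

/-- A digraph is nonlinear if no vertex has in-degree 1 and out-degree 1. -/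
def FinDigraph.Nonlinear {α : Type} [DecidableEq α] (G : FinDigraph α) : Prop :=
  ∀ v ∈ G.V, ¬ (G.inDeg v = 1 ∧ G.outDeg v = 1)

/-- Strong connectivity. -/
def StronglyConnected {α : Type} (G : FinDigraph α) : Prop :=
  ∀ a ∈ G.V, ∀ b ∈ G.V, Relation.ReflTransGen (fun x y => (x, y) ∈ G.E) a b

/-- A cycle digraph: strongly connected, at least 2 vertices, all vertices linear. -/
def IsCycleDigraph {α : Type} [DecidableEq α] (G : FinDigraph α) : Prop :=
  G.WellFormed ∧ 2 ≤ G.V.card ∧ StronglyConnected G ∧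
    ∀ v ∈ G.V, G.inDeg v = 1 ∧ G.outDeg v = 1

/-- A skew-symmetry of a digraph, as a permutation of its vertex set:
a fixed-point-free involution reversing arcs. -/
def IsSkewSym {α : Type} (G : FinDigraph α) (σ : Equiv.Perm {x // x ∈ G.V}) : Prop :=
  (∀ v, σ (σ v) = v) ∧ (∀ v, σ v ≠ v) ∧
  ∀ a b : {x // x ∈ G.V}, ((a : α), (b : α)) ∈ G.E → (((σ b : α)), ((σ a : α))) ∈ G.E

/-- A skew-symmetry has a unit if some vertex is joined by an arc to its image. -/
def HasUnit {α : Type} (G : FinDigraph α) (σ : Equiv.Perm {x // x ∈ G.V}) : Prop :=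
  ∃ v : {x // x ∈ G.V}, ((v : α), ((σ v : α))) ∈ G.E

/-- The literals over the variables of `F` are closed under complementation. -/
lemma compl_mem {F : Finset (Finset Lit)} {x : Lit} (h : x ∈ litsOf F) :
    Lit.compl x ∈ litsOf F := by
  simp only [litsOf, Lit.compl, Finset.mem_product] at h ⊢
  exact ⟨h.1, Finset.mem_univ _⟩

/-- Clause-set isomorphism, as an equivalence between the literals over the variables. -/
def CNFIsoE (F F' : Finset (Finset Lit))
    (e : {x // x ∈ litsOf F} ≃ {x // x ∈ litsOf F'}) : Prop :=
  (∀ x : {x // x ∈ litsOf F}, (e ⟨Lit.compl x.1, compl_mem x.2⟩ : Lit) = Lit.compl (e x : Lit)) ∧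
  F.image (fun C => C.image (fun y =>
      if h : y ∈ litsOf F then ((e ⟨y, h⟩ : {x // x ∈ litsOf F'}) : Lit) else y)) = F'

/-- An automorphism of a digraph, as a permutation of its vertex set preserving arcs. -/
def FinDigraphAut {α : Type} (G : FinDigraph α) (π : Equiv.Perm {x // x ∈ G.V}) : Prop :=
  ∀ a b : {x // x ∈ G.V}, ((a : α), (b : α)) ∈ G.E ↔ ((π a : α), (π b : α)) ∈ G.E

/-- Multiplicity of the edge between `u` and `v` in the underlying multigraph of a digraph. -/
def mult {α : Type} [DecidableEq α] (G : FinDigraph α) (u v : α) : ℕ :=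
  (if (u, v) ∈ G.E then 1 else 0) + (if (v, u) ∈ G.E then 1 else 0)

/-- `f` is an isomorphism between the underlying multigraphs of two digraphs. -/
def MultigraphIso {α β : Type} [DecidableEq α] [DecidableEq β]
    (G : FinDigraph α) (G' : FinDigraph β) (f : α → β) : Prop :=
  Set.BijOn f ↑G.V ↑G'.V ∧ ∀ u ∈ G.V, ∀ v ∈ G.V, mult G u v = mult G' (f u) (f v)

/-- `f` is an isomorphism between the underlying graphs of two digraphs. -/
def GraphIso {α β : Type} (G : FinDigraph α) (G' : FinDigraph β) (f : α → β) : Prop :=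
  Set.BijOn f ↑G.V ↑G'.V ∧ ∀ u ∈ G.V, ∀ v ∈ G.V,
    (((u, v) ∈ G.E ∨ (v, u) ∈ G.E) ↔ ((f u, f v) ∈ G'.E ∨ (f v, f u) ∈ G'.E))

/-- The transpose of a digraph: all arcs reversed. -/
def FinDigraph.transpose {α : Type} [DecidableEq α] (G : FinDigraph α) : FinDigraph α :=
  ⟨G.V, G.E.image (fun p => (p.2, p.1))⟩

/-- DP-reduction on variable `v`: replace all clauses containing `v` or `v̄` by all
their non-tautological resolvents on `v`. -/
def DP (v : ℕ) (F : Finset (Finset Lit)) : Finset (Finset Lit) :=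
  (F.filter (fun C => (v, true) ∉ C ∧ (v, false) ∉ C)) ∪
  ((((F.filter (fun C => (v, true) ∈ C)) ×ˢ (F.filter (fun C => (v, false) ∈ C))).image
      (fun p => (p.1.erase (v, true)) ∪ (p.2.erase (v, false)))).filter
    (fun C => ∀ x ∈ C, Lit.compl x ∉ C))

/-- A variable is singular if one of its literals has literal-degree 1. -/
def Singular (F : Finset (Finset Lit)) (v : ℕ) : Prop :=
  ldeg F (v, true) = 1 ∨ ldeg F (v, false) = 1

/-- The "middle part" `M_n = {{v̄_1,v_2},…,{v̄_{n−1},v_n}}`, with variables `1,…,n`. -/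
def Mn (n : ℕ) : Finset (Finset Lit) :=
  (Finset.Icc 1 (n - 1)).image (fun i => ({(i, false), (i + 1, true)} : Finset Lit))

def famU2 (n : ℕ) : Finset (Finset Lit) :=
  Mn n ∪ {({((1 : ℕ), true)} : Finset Lit), ({((n : ℕ), false)} : Finset Lit)}

def famU1 (n i : ℕ) : Finset (Finset Lit) :=
  Mn n ∪ {({((1 : ℕ), true)} : Finset Lit), ({((n : ℕ), false), ((i : ℕ), false)} : Finset Lit)}

def famU0s (n i : ℕ) : Finset (Finset Lit) :=
  Mn n ∪ {({((1 : ℕ), true), ((i : ℕ), true)} : Finset Lit),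
          ({((n : ℕ), false), ((i : ℕ), false)} : Finset Lit)}

def famU0 (n x y : ℕ) : Finset (Finset Lit) :=
  Mn n ∪ {({((1 : ℕ), true), ((x : ℕ), true)} : Finset Lit),
          ({((n : ℕ), false), ((y : ℕ), false)} : Finset Lit)}

/-- Membership in one of the four families (with the stated parameter ranges). -/
def InFam (G : Finset (Finset Lit)) : Prop :=
  (∃ n, 1 ≤ n ∧ G = famU2 n) ∨
  (∃ n i, 2 ≤ n ∧ 1 ≤ i ∧ i ≤ n - 1 ∧ G = famU1 n i) ∨
  (∃ n i, 3 ≤ n ∧ 2 ≤ i ∧ 2 * i ≤ n + 1 ∧ G = famU0s n i) ∨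
  (∃ n x y, 4 ≤ n ∧ 2 ≤ x ∧ x < y ∧ y ≤ n - 1 ∧ x + y ≤ n + 1 ∧ G = famU0 n x y)

/-- The number of unit-clauses of `F`. -/
def unitCount (F : Finset (Finset Lit)) : ℕ := (F.filter (fun C => C.card = 1)).card

/-- MU 2-clause-sets of deficiency `k` with exactly `n` variables. -/
def MU2dn (k : ℤ) (n : ℕ) : Type :=
  {F : Finset (Finset Lit) // MU2 F ∧ deficiency F = k ∧ (varsOf F).card = n}

/-- Isomorphism relation on `MU2dn k n`. -/
def isoRel {k : ℤ} {n : ℕ} (F F' : MU2dn k n) : Prop := ∃ f, CNFIso F.1 F'.1 f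

/-- The number of isomorphism classes of MU 2-clause-sets of deficiency `k`
with exactly `n` variables. -/
noncomputable def numClasses (k : ℤ) (n : ℕ) : ℕ := Nat.card (Quot (@isoRel k n))

/-- Equivalence of binary bracelets of length `m`: rotations and reflections of the
cyclic index set. -/
def BraceletRel (m : ℕ) (b b' : ZMod m → Bool) : Prop :=
  ∃ (r : ZMod m) (s : Bool), ∀ i, b' i = b (if s then r - i else i + r)

/-- Digraph-isomorphism relation on nonlinear `m`-WDCs. -/
def NonlinWDCRel (m : ℕ) (G G' : {G : FinDigraph ℕ // IsWDC m G ∧ G.Nonlinear}) : Prop :=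
  ∃ f : ℕ → ℕ, DigraphIso G.1 G'.1 f

/-- `H` is a subdigraph of `G`. -/
def Subdigraph {α : Type} (H G : FinDigraph α) : Prop := H.V ⊆ G.V ∧ H.E ⊆ G.E

lemma Lit.compl_compl (p : Lit) : Lit.compl (Lit.compl p) = p := by
  simp [Lit.compl]

lemma Lit.compl_fst (p : Lit) : (Lit.compl p).1 = p.1 := rfl

lemma Lit.compl_ne (p : Lit) : Lit.compl p ≠ p := by
  rcases p with ⟨v, b⟩
  cases b <;> simp [Lit.compl]

lemma Lit.eq_or_eq_compl {p q : Lit} (h : p.1 = q.1) : p = q ∨ p = Lit.compl q := by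
  rcases p with ⟨v, b⟩
  rcases q with ⟨w, c⟩
  cases b <;> cases c <;> simp_all [Lit.compl]

lemma litVal_compl (φ : ℕ → Bool) (p : Lit) : LitVal φ (Lit.compl p) = !LitVal φ p := by
  rcases p with ⟨v, b⟩
  cases b <;> simp [LitVal, Lit.compl]

lemma mem_varsOf {F : Finset (Finset Lit)} {v : ℕ} :
    v ∈ varsOf F ↔ ∃ C ∈ F, ∃ q ∈ C, q.1 = v := by
  simp [varsOf]

lemma mem_litsOf {F : Finset (Finset Lit)} {p : Lit} : p ∈ litsOf F ↔ p.1 ∈ varsOf F := by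
  simp [litsOf]

lemma fst_mem_varsOf {F : Finset (Finset Lit)} {C : Finset Lit} {p : Lit}
    (hC : C ∈ F) (hp : p ∈ C) : p.1 ∈ varsOf F :=
  mem_varsOf.2 ⟨C, hC, p, hp, rfl⟩

lemma subset_litsOf {F : Finset (Finset Lit)} {C : Finset Lit} (hC : C ∈ F) : C ⊆ litsOf F :=
  fun _ hp => mem_litsOf.2 (fst_mem_varsOf hC hp)

/-- The assignment `φ` makes some literal of the clause `C` true. -/
def Satisfies (φ : ℕ → Bool) (C : Finset Lit) : Prop := ∃ x ∈ C, LitVal φ x = true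

lemma satisfies_pair {φ : ℕ → Bool} {p q : Lit} :
    Satisfies φ {p, q} ↔ LitVal φ p = true ∨ LitVal φ q = true := by
  simp [Satisfies]

lemma Satisfies.mono {φ : ℕ → Bool} {C D : Finset Lit} (h : Satisfies φ C) (hCD : C ⊆ D) :
    Satisfies φ D := by
  obtain ⟨x, hx, h⟩ := h
  exact ⟨x, hCD hx, h⟩

/-- The assignment obtained from `φ` by making the literal `p` true. -/
def makeTrue (φ : ℕ → Bool) (p : Lit) : ℕ → Bool := Function.update φ p.1 p.2

lemma litVal_makeTrue_self (φ : ℕ → Bool) (p : Lit) : LitVal (makeTrue φ p) p = true := by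
  rcases p with ⟨v, b⟩
  cases b <;> simp [LitVal, makeTrue]

lemma litVal_makeTrue_of_ne (φ : ℕ → Bool) {p q : Lit} (h : q.1 ≠ p.1) :
    LitVal (makeTrue φ p) q = LitVal φ q := by
  simp [LitVal, makeTrue, Function.update_of_ne h]

lemma Satisfies.makeTrue {φ : ℕ → Bool} {C : Finset Lit} {p : Lit} (h : Satisfies φ C)
    (hp : Lit.compl p ∉ C) : Satisfies (makeTrue φ p) C := by
  obtain ⟨x, hx, h⟩ := h
  by_cases hxp : x.1 = p.1
  · rcases Lit.eq_or_eq_compl hxp with rfl | rfl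
    · exact ⟨x, hx, litVal_makeTrue_self φ x⟩
    · exact absurd hx hp
  · exact ⟨x, hx, by rwa [litVal_makeTrue_of_ne φ hxp]⟩

/-- Every assignment satisfying all clauses of `F` other than `C` makes `p` true. -/
def EntailsWithout (F : Finset (Finset Lit)) (C : Finset Lit) (p : Lit) : Prop :=
  ∀ φ : ℕ → Bool, (∀ D ∈ F, D ≠ C → Satisfies φ D) → LitVal φ p = true

lemma image_image_of_leftInvOn {F : Finset (Finset Lit)} {f g : Lit → Lit}
    (hg : ∀ p ∈ litsOf F, g (f p) = p) {C : Finset Lit} (hC : C ∈ F) :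
    (C.image f).image g = C := by
  rw [Finset.image_image]
  conv_rhs => rw [← Finset.image_id (s := C)]
  exact Finset.image_congr fun p hp => hg p (subset_litsOf hC hp)

lemma CNFIso.exists_inverse {F F' : Finset (Finset Lit)} {f : Lit → Lit} (h : CNFIso F F' f) :
    ∃ g, CNFIso F' F g ∧ ∀ p ∈ litsOf F, g (f p) = p := by
  obtain ⟨hbij, hcompl, himg⟩ := h
  have hinv := hbij.invOn_invFunOn
  set g := Function.invFunOn f ↑(litsOf F)
  have hl : ∀ p ∈ litsOf F, g (f p) = p := fun p hp => hinv.1 hp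
  have hgb : Set.BijOn g ↑(litsOf F') ↑(litsOf F) :=
    Set.BijOn.symm ⟨hinv.2, hinv.1⟩ hbij
  refine ⟨g, ⟨hgb, fun q hq => ?_, ?_⟩, hl⟩
  · obtain ⟨p, hp, rfl⟩ := hbij.surjOn hq
    have hp' : p ∈ litsOf F := hp
    rw [← hcompl p hp', hl p hp', hl _ (compl_mem hp')]
  · rw [← himg, Finset.image_image]
    conv_rhs => rw [← Finset.image_id (s := F)]
    exact Finset.image_congr fun C hC => image_image_of_leftInvOn hl hC

lemma CNFIso.image_injOn {F F' : Finset (Finset Lit)} {f : Lit → Lit} (h : CNFIso F F' f) :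
    Set.InjOn (fun C : Finset Lit => C.image f) ↑F := by
  obtain ⟨g, -, hl⟩ := h.exists_inverse
  intro C hC D hD hCD
  have := congrArg (Finset.image g) hCD
  simpa only [image_image_of_leftInvOn hl hC, image_image_of_leftInvOn hl hD] using this

lemma CNFIso.image_mem {F F' : Finset (Finset Lit)} {f : Lit → Lit} (h : CNFIso F F' f)
    {C : Finset Lit} (hC : C ∈ F) : C.image f ∈ F' :=
  h.2.2 ▸ Finset.mem_image_of_mem _ hC

lemma CNFIso.entailsWithout {F F' : Finset (Finset Lit)} {f : Lit → Lit} (h : CNFIso F F' f)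
    {C : Finset Lit} {p : Lit} (hC : C ∈ F) (hp : p ∈ litsOf F) (he : EntailsWithout F C p) :
    EntailsWithout F' (C.image f) (f p) := by
  intro φ hφ
  let ψ : ℕ → Bool := fun v => LitVal φ (f (v, true))
  have hψ : ∀ q ∈ litsOf F, LitVal ψ q = LitVal φ (f q) := by
    rintro ⟨v, b⟩ hq
    cases b
    · have := h.2.1 _ (compl_mem hq)
      rw [Lit.compl_compl] at this
      rw [this, litVal_compl]
      simp [LitVal, ψ, Lit.compl]
    · simp [LitVal, ψ]
  rw [← hψ p hp]
  refine he ψ fun D hD hDC => ?_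
  obtain ⟨q, hq, hqt⟩ := hφ (D.image f) (h.image_mem hD) fun he => hDC (h.image_injOn hD hC he)
  obtain ⟨r, hr, rfl⟩ := Finset.mem_image.1 hq
  exact ⟨r, hr, by rw [hψ r (subset_litsOf hD hr), hqt]⟩

lemma CNFIso.entailsWithout_iff {F F' : Finset (Finset Lit)} {f : Lit → Lit} (h : CNFIso F F' f)
    {C : Finset Lit} {p : Lit} (hC : C ∈ F) (hp : p ∈ litsOf F) :
    EntailsWithout F' (C.image f) (f p) ↔ EntailsWithout F C p := by
  refine ⟨fun he => ?_, h.entailsWithout hC hp⟩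
  obtain ⟨g, hg, hl⟩ := h.exists_inverse
  have := hg.entailsWithout (h.image_mem hC) (h.1.mapsTo hp) he
  rwa [hl p hp, image_image_of_leftInvOn hl hC] at this

open Classical in
/-- The number of clauses of `F` whose removal leaves a clause-set not entailing `p`. -/
noncomputable def essentialCount (F : Finset (Finset Lit)) (p : Lit) : ℕ :=
  (F.filter fun C => ¬ EntailsWithout F C p).card

/-- The least number of clauses essential for some literal. -/
noncomputable def minEssential (F : Finset (Finset Lit)) : ℕ :=
  sInf (essentialCount F '' ↑(litsOf F))

open Classical in
/-- The number of literals whose value is determined after removal of any clause. -/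
noncomputable def determinedCount (F : Finset (Finset Lit)) : ℕ :=
  ((litsOf F).filter fun p =>
    ∀ C ∈ F, EntailsWithout F C p ∨ EntailsWithout F C (Lit.compl p)).card

lemma CNFIso.essentialCount_eq {F F' : Finset (Finset Lit)} {f : Lit → Lit} (h : CNFIso F F' f)
    {p : Lit} (hp : p ∈ litsOf F) : essentialCount F' (f p) = essentialCount F p := by
  classical
  unfold essentialCount
  symm
  refine Finset.card_bij (fun C _ => C.image f) ?_ ?_ ?_
  · intro C hC
    rw [Finset.mem_filter] at hC ⊢
    exact ⟨h.image_mem hC.1, by rw [h.entailsWithout_iff hC.1 hp]; exact hC.2⟩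
  · intro C hC D hD hCD
    exact h.image_injOn (Finset.mem_filter.1 hC).1 (Finset.mem_filter.1 hD).1 hCD
  · intro C' hC'
    rw [Finset.mem_filter, ← h.2.2, Finset.mem_image] at hC'
    obtain ⟨⟨C, hC, rfl⟩, hne⟩ := hC'
    rw [h.2.2, h.entailsWithout_iff hC hp] at hne
    exact ⟨C, Finset.mem_filter.2 ⟨hC, hne⟩, rfl⟩

lemma CNFIso.minEssential_eq {F F' : Finset (Finset Lit)} {f : Lit → Lit} (h : CNFIso F F' f) :
    minEssential F = minEssential F' := by
  unfold minEssential
  rw [← h.1.image_eq, Set.image_image]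
  congr 1
  exact Set.image_congr fun p hp => (h.essentialCount_eq hp).symm

lemma CNFIso.determinedCount_eq {F F' : Finset (Finset Lit)} {f : Lit → Lit}
    (h : CNFIso F F' f) : determinedCount F = determinedCount F' := by
  classical
  have key : ∀ p ∈ litsOf F,
      ((∀ C ∈ F', EntailsWithout F' C (f p) ∨ EntailsWithout F' C (Lit.compl (f p))) ↔
        ∀ C ∈ F, EntailsWithout F C p ∨ EntailsWithout F C (Lit.compl p)) := by
    intro p hp
    have hF' : ∀ P : Finset Lit → Prop, (∀ C ∈ F', P C) ↔ ∀ C ∈ F, P (C.image f) := by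
      intro P
      rw [← h.2.2, Finset.forall_mem_image]
    rw [hF', ← h.2.1 p hp]
    refine forall₂_congr fun C hC => ?_
    rw [h.entailsWithout_iff hC hp, h.entailsWithout_iff hC (compl_mem hp)]
  unfold determinedCount
  refine Finset.card_bij (fun p _ => f p) ?_ ?_ ?_
  · intro p hp
    rw [Finset.mem_filter] at hp ⊢
    exact ⟨h.1.mapsTo hp.1, (key p hp.1).2 hp.2⟩
  · intro p hp q hq hpq
    exact h.1.injOn (Finset.mem_filter.1 hp).1 (Finset.mem_filter.1 hq).1 hpq
  · intro q hq
    rw [Finset.mem_filter] at hq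
    obtain ⟨p, hp, rfl⟩ := h.1.surjOn hq.1
    exact ⟨p, Finset.mem_filter.2 ⟨hp, (key p hp).1 hq.2⟩, rfl⟩

/-- First literal of the `j`-th chain clause. -/
def chainFst (l : ℕ → Lit) (x j : ℕ) : Lit := if j = 0 then l x else Lit.compl (l j)

/-- Second literal of the `j`-th chain clause. -/
def chainSnd (l : ℕ → Lit) (n y j : ℕ) : Lit := if j = n then Lit.compl (l y) else l (j + 1)

/-- The `j`-th chain clause: `{l_x, l_1}` for `j = 0`, `{l̄_j, l_{j+1}}` for `0 < j < n`,
and `{l̄_n, l̄_y}` for `j = n`. -/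
def chainClause (l : ℕ → Lit) (n x y j : ℕ) : Finset Lit := {chainFst l x j, chainSnd l n y j}

/-- The clause-set `{l_1, l_x}, {l̄_1, l_2}, …, {l̄_{n-1}, l_n}, {l̄_n, l̄_y}`. -/
def chain (l : ℕ → Lit) (n x y : ℕ) : Finset (Finset Lit) :=
  (Finset.range (n + 1)).image (chainClause l n x y)

/-- The positive literals `1, 2, …`. -/
def posLit (i : ℕ) : Lit := (i, true)

lemma mem_chain {l : ℕ → Lit} {n x y : ℕ} {C : Finset Lit} :
    C ∈ chain l n x y ↔ ∃ j ≤ n, chainClause l n x y j = C := by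
  simp [chain]

lemma varsOf_chain {l : ℕ → Lit} {n x y : ℕ} (hx : 1 ≤ x) (hxn : x ≤ n) (hy : 1 ≤ y)
    (hyn : y ≤ n) : varsOf (chain l n x y) = (Finset.Icc 1 n).image fun i => (l i).1 := by
  ext v
  simp only [mem_varsOf, mem_chain, Finset.mem_image, Finset.mem_Icc]
  constructor
  · rintro ⟨C, ⟨j, hj, rfl⟩, q, hq, rfl⟩
    simp only [chainClause, Finset.mem_insert, Finset.mem_singleton, chainFst, chainSnd] at hq
    rcases hq with rfl | rfl
    · split_ifs with h
      · exact ⟨x, ⟨hx, hxn⟩, rfl⟩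
      · exact ⟨j, by omega, rfl⟩
    · split_ifs with h
      · exact ⟨y, ⟨hy, hyn⟩, rfl⟩
      · exact ⟨j + 1, by omega, rfl⟩
  · rintro ⟨i, hi, rfl⟩
    refine ⟨_, ⟨i, hi.2, rfl⟩, chainFst l x i, by simp [chainClause], ?_⟩
    rw [chainFst, if_neg (by omega), Lit.compl_fst]

lemma chain_reverse {l : ℕ → Lit} {n x y : ℕ} (hx : 1 ≤ x) (hxn : x ≤ n) (hy : 1 ≤ y)
    (hyn : y ≤ n) :
    chain l n x y = chain (fun i => Lit.compl (l (n + 1 - i))) n (n + 1 - y) (n + 1 - x) := by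
  have key : ∀ j ≤ n, chainClause (fun i => Lit.compl (l (n + 1 - i))) n (n + 1 - y) (n + 1 - x) j
      = chainClause l n x y (n - j) := by
    intro j hj
    have h1 : chainFst (fun i => Lit.compl (l (n + 1 - i))) (n + 1 - y) j
        = chainSnd l n y (n - j) := by
      unfold chainFst chainSnd
      rcases Nat.eq_zero_or_pos j with rfl | h
      · simp [show n + 1 - (n + 1 - y) = y by omega]
      · rw [if_neg (by omega), if_neg (by omega), Lit.compl_compl]
        congr 1
        omega
    have h2 : chainSnd (fun i => Lit.compl (l (n + 1 - i))) n (n + 1 - x) j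
        = chainFst l x (n - j) := by
      unfold chainFst chainSnd
      rcases Nat.eq_or_lt_of_le hj with rfl | h
      · simp [show j + 1 - (j + 1 - x) = x by omega, Lit.compl_compl]
      · rw [if_neg (by omega), if_neg (by omega)]
        simp only [Nat.add_sub_add_right]
    rw [chainClause, chainClause, h1, h2, Finset.pair_comm]
  ext C
  simp only [mem_chain]
  constructor
  · rintro ⟨j, hj, rfl⟩
    exact ⟨n - j, by omega, by rw [key _ (by omega), Nat.sub_sub_self hj]⟩
  · rintro ⟨j, hj, rfl⟩
    exact ⟨n - j, by omega, (key j hj).symm⟩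

/-- The literal map sending the literal `i` to `l i`. -/
def substLit (l : ℕ → Lit) (p : Lit) : Lit := if p.2 then l p.1 else Lit.compl (l p.1)

lemma substLit_compl (l : ℕ → Lit) (p : Lit) :
    substLit l (Lit.compl p) = Lit.compl (substLit l p) := by
  rcases p with ⟨v, b⟩
  cases b <;> simp [substLit, Lit.compl]

lemma substLit_fst (l : ℕ → Lit) (p : Lit) : (substLit l p).1 = (l p.1).1 := by
  unfold substLit
  split_ifs <;> rfl

lemma chainClause_image_substLit (l : ℕ → Lit) (n x y j : ℕ) :
    (chainClause posLit n x y j).image (substLit l) = chainClause l n x y j := by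
  have hpos : ∀ i, substLit l (posLit i) = l i := fun i => by simp [substLit, posLit]
  simp only [chainClause, Finset.image_insert, Finset.image_singleton, chainFst, chainSnd,
    apply_ite (substLit l), substLit_compl, hpos]

lemma cnfIso_chain {l : ℕ → Lit} {n x y : ℕ} (hx : 1 ≤ x) (hxn : x ≤ n) (hy : 1 ≤ y)
    (hyn : y ≤ n) (hl : Set.InjOn (fun i => (l i).1) (Set.Icc 1 n)) :
    CNFIso (chain posLit n x y) (chain l n x y) (substLit l) := by
  have hlits : ∀ p, p ∈ litsOf (chain posLit n x y) ↔ p.1 ∈ Set.Icc 1 n := by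
    intro p
    rw [mem_litsOf, varsOf_chain hx hxn hy hyn]
    simp [posLit]
  have hlits' : ∀ p, p ∈ litsOf (chain l n x y) ↔ ∃ i ∈ Set.Icc 1 n, (l i).1 = p.1 := by
    intro p
    rw [mem_litsOf, varsOf_chain hx hxn hy hyn]
    simp
  refine ⟨⟨?_, ?_, ?_⟩, fun p _ => substLit_compl l p, ?_⟩
  · intro p hp
    exact (hlits' _).2 ⟨p.1, (hlits p).1 hp, (substLit_fst l p).symm⟩
  · intro p hp q hq hpq
    have hv : p.1 = q.1 := by
      refine hl ((hlits p).1 hp) ((hlits q).1 hq) ?_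
      simpa only [substLit_fst] using congrArg Prod.fst hpq
    rcases Lit.eq_or_eq_compl hv with h | h
    · exact h
    · rw [h, substLit_compl] at hpq
      exact absurd hpq (Lit.compl_ne _)
  · intro q hq
    obtain ⟨i, hi, hiq⟩ := (hlits' q).1 hq
    rcases Lit.eq_or_eq_compl hiq.symm with h | h
    · exact ⟨(i, true), (hlits _).2 hi, by simp [substLit, h]⟩
    · exact ⟨(i, false), (hlits _).2 hi, by simp [substLit, h]⟩
  · simp only [chain, Finset.image_image]
    exact Finset.image_congr fun j _ => chainClause_image_substLit l n x y j

lemma satisfies_chainClause_posLit {φ : ℕ → Bool} {n x y j : ℕ} :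
    Satisfies φ (chainClause posLit n x y j) ↔
      (if j = 0 then φ x = true else φ j = false) ∨
      (if j = n then φ y = false else φ (j + 1) = true) := by
  rw [chainClause, satisfies_pair]
  unfold chainFst chainSnd
  refine or_congr ?_ ?_ <;> split_ifs <;> simp [posLit, LitVal, Lit.compl]

lemma true_of_chain {φ : ℕ → Bool} {a b : ℕ} (hab : a ≤ b)
    (h : ∀ k, a ≤ k → k < b → φ k = true → φ (k + 1) = true) (ha : φ a = true) :
    φ b = true := by
  induction b, hab using Nat.le_induction with
  | base => exact ha
  | succ b hab ih => exact h b hab (by omega) (ih fun k h1 h2 => h k h1 (by omega))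

/-- The least model of the chain without its `j`-th clause. -/
def lowModel (x j i : ℕ) : Bool := decide (i ≤ j ∧ (x ≤ j → x ≤ i))

/-- The greatest model of the chain without its `j`-th clause. -/
def highModel (y j i : ℕ) : Bool := decide (i ≤ j ∨ (j < y ∧ y < i))

lemma satisfies_lowModel {n x y i j : ℕ} (hx : 1 ≤ x) (hxy : x ≤ y) (hyn : y ≤ n) (hi : i ≤ n)
    (hj : j ≤ n) (hij : i ≠ j) : Satisfies (lowModel x j) (chainClause posLit n x y i) := by
  rw [satisfies_chainClause_posLit]
  simp only [lowModel, decide_eq_true_eq, decide_eq_false_iff_not]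
  split_ifs <;> omega

lemma satisfies_highModel {n x y i j : ℕ} (hx : 1 ≤ x) (hxy : x ≤ y) (hyn : y ≤ n) (hi : i ≤ n)
    (hj : j ≤ n) (hij : i ≠ j) : Satisfies (highModel y j) (chainClause posLit n x y i) := by
  rw [satisfies_chainClause_posLit]
  simp only [highModel, decide_eq_true_eq, decide_eq_false_iff_not]
  split_ifs <;> omega

section Models

variable {φ : ℕ → Bool} {n x y j : ℕ}

lemma chain_step (h : ∀ i ≤ n, i ≠ j → Satisfies φ (chainClause posLit n x y i)) {k : ℕ}
    (hk : 1 ≤ k) (hkn : k < n) (hkj : k ≠ j) (hφ : φ k = true) : φ (k + 1) = true := by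
  have := satisfies_chainClause_posLit.1 (h k hkn.le hkj)
  rw [if_neg (by omega), if_neg (by omega), hφ] at this
  simpa using this

lemma chain_first (h : ∀ i ≤ n, i ≠ j → Satisfies φ (chainClause posLit n x y i))
    (hn : 1 ≤ n) (hj : j ≠ 0) : φ x = true ∨ φ 1 = true := by
  have := satisfies_chainClause_posLit.1 (h 0 (by omega) hj.symm)
  rwa [if_pos rfl, if_neg (by omega)] at this

lemma chain_last (h : ∀ i ≤ n, i ≠ j → Satisfies φ (chainClause posLit n x y i))
    (hn : 1 ≤ n) (hj : j ≠ n) : φ n = false ∨ φ y = false := by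
  have := satisfies_chainClause_posLit.1 (h n le_rfl hj.symm)
  rwa [if_neg (by omega), if_pos rfl] at this

lemma chain_propagate (h : ∀ i ≤ n, i ≠ j → Satisfies φ (chainClause posLit n x y i)) {a b : ℕ}
    (ha : 1 ≤ a) (hab : a ≤ b) (hb : b ≤ n) (hj : j < a ∨ b ≤ j) (hφ : φ a = true) :
    φ b = true :=
  true_of_chain hab (fun _ h1 h2 => chain_step h (by omega) (by omega) (by omega)) hφ

lemma true_of_lowModel (h : ∀ i ≤ n, i ≠ j → Satisfies φ (chainClause posLit n x y i))
    (hx : 1 ≤ x) (hxy : x ≤ y) (hyn : y ≤ n) (hj : j ≤ n) {i : ℕ} (hi : 1 ≤ i)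
    (hlow : lowModel x j i = true) : φ i = true := by
  simp only [lowModel, decide_eq_true_eq] at hlow
  obtain ⟨hij, hxi⟩ := hlow
  have hfirst := chain_first h (by omega) (by omega)
  by_cases hxj : x ≤ j
  · have : φ x = true := hfirst.elim id (chain_propagate h le_rfl hx (by omega) (by omega))
    exact chain_propagate h hx (hxi hxj) (by omega) (by omega) this
  · refine chain_propagate h le_rfl hi (by omega) (by omega) (hfirst.resolve_left fun hφ => ?_)
    have h1 : φ y = true := chain_propagate h hx hxy hyn (by omega) hφ
    have h2 : φ n = true := chain_propagate h (by omega) hyn le_rfl (by omega) h1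
    rcases chain_last h (by omega) (by omega) with h3 | h3 <;> simp_all

lemma highModel_of_true (h : ∀ i ≤ n, i ≠ j → Satisfies φ (chainClause posLit n x y i))
    (hx : 1 ≤ x) (hxy : x ≤ y) (hyn : y ≤ n) {i : ℕ} (hi : 1 ≤ i) (hin : i ≤ n)
    (hφ : φ i = true) : highModel y j i = true := by
  by_contra hhigh
  simp only [highModel, decide_eq_true_eq] at hhigh
  have hlast := chain_last h (by omega) (by omega)
  have hφn : φ n = true := chain_propagate h hi hin le_rfl (by omega) hφ
  have hφy : φ y = true := by
    by_cases hjy : j < y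
    · exact chain_propagate h hi (by omega) hyn (by omega) hφ
    · exact (chain_first h (by omega) (by omega)).elim
        (chain_propagate h hx hxy hyn (by omega))
        (chain_propagate h le_rfl (by omega) hyn (by omega))
  rcases hlast with h3 | h3 <;> simp_all

end Models

section Standard

variable {n x y : ℕ}

lemma not_forall_satisfies_chain (hx : 1 ≤ x) (hxy : x ≤ y) (hyn : y ≤ n) (φ : ℕ → Bool) :
    ¬ ∀ i ≤ n, Satisfies φ (chainClause posLit n x y i) := by
  intro h
  have h' : ∀ i ≤ n, i ≠ n + 1 → Satisfies φ (chainClause posLit n x y i) := fun i hi _ => h i hi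
  have hφx : φ x = true := (chain_first h' (by omega) (by omega)).elim id
    (chain_propagate h' le_rfl hx (by omega) (by omega))
  have hφy : φ y = true := chain_propagate h' hx hxy hyn (by omega) hφx
  have hφn : φ n = true := chain_propagate h' (by omega) hyn le_rfl (by omega) hφy
  rcases chain_last h' (by omega) (by omega) with h3 | h3 <;> simp_all

lemma chainClause_injOn (hx : 1 ≤ x) (hxy : x ≤ y) (hyn : y ≤ n) :
    Set.InjOn (chainClause posLit n x y) ↑(Finset.range (n + 1)) := by
  intro i hi j hj hij
  simp only [Finset.coe_range, Set.mem_Iio] at hi hj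
  by_contra hne
  refine not_forall_satisfies_chain hx hxy hyn (lowModel x j) fun k hk => ?_
  by_cases hkj : k = j
  · subst hkj
    exact hij ▸ satisfies_lowModel hx hxy hyn (by omega) (by omega) hne
  · exact satisfies_lowModel hx hxy hyn hk (by omega) hkj

lemma forall_ne_satisfies_iff (hx : 1 ≤ x) (hxy : x ≤ y) (hyn : y ≤ n) {j : ℕ} (hj : j ≤ n)
    (φ : ℕ → Bool) :
    (∀ D ∈ chain posLit n x y, D ≠ chainClause posLit n x y j → Satisfies φ D) ↔
      ∀ i ≤ n, i ≠ j → Satisfies φ (chainClause posLit n x y i) := by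
  constructor
  · intro h i hi hij
    refine h _ (mem_chain.2 ⟨i, hi, rfl⟩) fun he => hij ?_
    exact chainClause_injOn hx hxy hyn (by simpa using Nat.lt_succ_of_le hi)
      (by simpa using Nat.lt_succ_of_le hj) he
  · intro h D hD hne
    obtain ⟨i, hi, rfl⟩ := mem_chain.1 hD
    exact h i hi fun he => hne (he ▸ rfl)

lemma entailsWithout_chain_pos (hx : 1 ≤ x) (hxy : x ≤ y) (hyn : y ≤ n) {i j : ℕ} (hj : j ≤ n)
    (hi : 1 ≤ i) :
    EntailsWithout (chain posLit n x y) (chainClause posLit n x y j) (i, true) ↔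
      i ≤ j ∧ (x ≤ j → x ≤ i) := by
  have hlow : lowModel x j i = true ↔ i ≤ j ∧ (x ≤ j → x ≤ i) := by
    simp only [lowModel, decide_eq_true_eq]
  rw [← hlow]
  simp only [EntailsWithout, forall_ne_satisfies_iff hx hxy hyn hj]
  constructor
  · intro h
    simpa [LitVal] using h (lowModel x j) fun k hk hkj => satisfies_lowModel hx hxy hyn hk hj hkj
  · intro h φ hφ
    simpa [LitVal] using true_of_lowModel hφ hx hxy hyn hj hi h

lemma entailsWithout_chain_neg (hx : 1 ≤ x) (hxy : x ≤ y) (hyn : y ≤ n) {i j : ℕ} (hj : j ≤ n)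
    (hi : 1 ≤ i) (hin : i ≤ n) :
    EntailsWithout (chain posLit n x y) (chainClause posLit n x y j) (i, false) ↔
      ¬ (i ≤ j ∨ (j < y ∧ y < i)) := by
  have hhigh : highModel y j i = true ↔ i ≤ j ∨ (j < y ∧ y < i) := by
    simp only [highModel, decide_eq_true_eq]
  rw [← hhigh]
  simp only [EntailsWithout, forall_ne_satisfies_iff hx hxy hyn hj]
  constructor
  · intro h
    simpa [LitVal] using
      h (highModel y j) fun k hk hkj => satisfies_highModel hx hxy hyn hk hj hkj
  · intro h φ hφ
    by_contra hφi
    exact h (highModel_of_true hφ hx hxy hyn hi hin (by simpa [LitVal] using hφi))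

lemma mem_litsOf_chain (hx : 1 ≤ x) (hxy : x ≤ y) (hyn : y ≤ n) {p : Lit} :
    p ∈ litsOf (chain posLit n x y) ↔ 1 ≤ p.1 ∧ p.1 ≤ n := by
  rw [mem_litsOf, varsOf_chain hx (by omega) (by omega) hyn]
  simp [posLit]

open Classical in
lemma essentialCount_chain (hx : 1 ≤ x) (hxy : x ≤ y) (hyn : y ≤ n) (p : Lit) :
    essentialCount (chain posLit n x y) p = ((Finset.range (n + 1)).filter fun j =>
      ¬ EntailsWithout (chain posLit n x y) (chainClause posLit n x y j) p).card := by
  conv_lhs => rw [essentialCount, chain, Finset.filter_image]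
  exact Finset.card_image_of_injOn
    ((chainClause_injOn hx hxy hyn).mono (Finset.coe_subset.2 (Finset.filter_subset _ _)))

lemma le_essentialCount_chain (hx : 1 ≤ x) (hxy : x ≤ y) (hxyn : x + y ≤ n + 1) {p : Lit}
    (hp : p ∈ litsOf (chain posLit n x y)) : x ≤ essentialCount (chain posLit n x y) p := by
  classical
  have hyn : y ≤ n := by omega
  rw [mem_litsOf_chain hx hxy hyn] at hp
  rw [essentialCount_chain hx hxy hyn]
  have key : ∀ a b : ℕ, x ≤ b - a → b ≤ n + 1 → (∀ j, a ≤ j → j < b →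
      ¬ EntailsWithout (chain posLit n x y) (chainClause posLit n x y j) p) →
      x ≤ ((Finset.range (n + 1)).filter fun j =>
        ¬ EntailsWithout (chain posLit n x y) (chainClause posLit n x y j) p).card := by
    intro a b hab hb h
    rw [← Nat.card_Ico a b] at hab
    refine hab.trans (Finset.card_le_card fun j hj => ?_)
    rw [Finset.mem_Ico] at hj
    exact Finset.mem_filter.2 ⟨Finset.mem_range.2 (by omega), h j hj.1 hj.2⟩
  obtain ⟨i, b⟩ := p
  simp only at hp
  cases b
  · by_cases hiy : i ≤ y
    · refine key y (n + 1) (by omega) le_rfl fun j h1 h2 => ?_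
      rw [entailsWithout_chain_neg hx hxy hyn (by omega) hp.1 hp.2]
      omega
    · refine key 0 y (by omega) (by omega) fun j h1 h2 => ?_
      rw [entailsWithout_chain_neg hx hxy hyn (by omega) hp.1 hp.2]
      omega
  · by_cases hxi : x ≤ i
    · refine key 0 x (by omega) (by omega) fun j h1 h2 => ?_
      rw [entailsWithout_chain_pos hx hxy hyn (by omega) hp.1]
      omega
    · refine key x (n + 1) (by omega) le_rfl fun j h1 h2 => ?_
      rw [entailsWithout_chain_pos hx hxy hyn (by omega) hp.1]
      omega

lemma minEssential_chain (hx : 1 ≤ x) (hxy : x ≤ y) (hxyn : x + y ≤ n + 1) :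
    minEssential (chain posLit n x y) = x := by
  classical
  have hyn : y ≤ n := by omega
  have hmem : (x, true) ∈ litsOf (chain posLit n x y) :=
    (mem_litsOf_chain hx hxy hyn).2 ⟨hx, by simp only; omega⟩
  have hval : essentialCount (chain posLit n x y) (x, true) = x := by
    rw [essentialCount_chain hx hxy hyn]
    conv_rhs => rw [← Finset.card_range x]
    congr 1
    ext j
    simp only [Finset.mem_filter, Finset.mem_range]
    constructor
    · rintro ⟨hj, h⟩
      rw [entailsWithout_chain_pos hx hxy hyn (by omega) hx] at h
      omega
    · intro hj
      refine ⟨by omega, ?_⟩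
      rw [entailsWithout_chain_pos hx hxy hyn (by omega) hx]
      omega
  refine le_antisymm (Nat.sInf_le ⟨_, hmem, hval⟩) ?_
  refine le_csInf ⟨_, _, hmem, rfl⟩ ?_
  rintro _ ⟨p, hp, rfl⟩
  exact le_essentialCount_chain hx hxy hxyn hp

lemma determinedCount_chain (hx : 1 ≤ x) (hxy : x ≤ y) (hyn : y ≤ n) :
    determinedCount (chain posLit n x y) = (y + 1 - x) * 2 := by
  classical
  have : ((litsOf (chain posLit n x y)).filter fun p => ∀ C ∈ chain posLit n x y,
      EntailsWithout (chain posLit n x y) C p ∨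
        EntailsWithout (chain posLit n x y) C (Lit.compl p)) =
      Finset.Icc x y ×ˢ (Finset.univ : Finset Bool) := by
    ext ⟨i, b⟩
    simp only [Finset.mem_filter, mem_litsOf_chain hx hxy hyn, Finset.mem_product,
      Finset.mem_univ, and_true, Finset.mem_Icc]
    have key : 1 ≤ i → i ≤ n → ((∀ C ∈ chain posLit n x y,
        EntailsWithout (chain posLit n x y) C (i, b) ∨
          EntailsWithout (chain posLit n x y) C (Lit.compl (i, b))) ↔
        ∀ j ≤ n, (i ≤ j ∧ (x ≤ j → x ≤ i)) ∨ ¬ (i ≤ j ∨ (j < y ∧ y < i))) := by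
      intro h1 h2
      simp only [mem_chain, forall_exists_index, and_imp]
      have hj : ∀ j ≤ n, (EntailsWithout (chain posLit n x y) (chainClause posLit n x y j) (i, b) ∨
          EntailsWithout (chain posLit n x y) (chainClause posLit n x y j) (Lit.compl (i, b)) ↔
          (i ≤ j ∧ (x ≤ j → x ≤ i)) ∨ ¬ (i ≤ j ∨ (j < y ∧ y < i))) := by
        intro j hj
        rw [← entailsWithout_chain_pos hx hxy hyn hj h1,
          ← entailsWithout_chain_neg hx hxy hyn hj h1 h2]
        cases b
        · exact or_comm
        · rfl
      constructor
      · intro h j hjn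
        exact (hj j hjn).1 (h _ j hjn rfl)
      · rintro h _ j hjn rfl
        exact (hj j hjn).2 (h j hjn)
    constructor
    · rintro ⟨⟨h1, h2⟩, h⟩
      rw [key h1 h2] at h
      have hn := h n le_rfl
      have h0 := h 0 (by omega)
      omega
    · rintro ⟨h1, h2⟩
      refine ⟨by omega, (key (by omega) (by omega)).2 fun j hj => ?_⟩
      omega
  rw [determinedCount, this, Finset.card_product, Nat.card_Icc]
  rfl

lemma chain_mu2 (hx : 1 ≤ x) (hxy : x ≤ y) (hyn : y ≤ n) : MU2 (chain posLit n x y) := by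
  refine ⟨⟨?_, ?_, ?_⟩, ?_⟩
  · intro C hC
    obtain ⟨j, hj, rfl⟩ := mem_chain.1 hC
    intro p hp
    simp only [chainClause, Finset.mem_insert, Finset.mem_singleton, chainFst, chainSnd] at hp ⊢
    rcases hp with rfl | rfl <;> split_ifs <;>
      simp [posLit, Lit.compl] <;> omega
  · rintro ⟨φ, hφ⟩
    exact not_forall_satisfies_chain hx hxy hyn φ fun i hi => hφ _ (mem_chain.2 ⟨i, hi, rfl⟩)
  · intro G hG
    obtain ⟨C, hC, hCG⟩ := Finset.exists_of_ssubset hG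
    obtain ⟨j, hj, rfl⟩ := mem_chain.1 hC
    refine ⟨lowModel x j, fun D hD => ?_⟩
    obtain ⟨i, hi, rfl⟩ := mem_chain.1 (hG.subset hD)
    exact satisfies_lowModel hx hxy hyn hi hj fun h => hCG (h ▸ hD)
  · intro C hC
    obtain ⟨j, hj, rfl⟩ := mem_chain.1 hC
    exact Finset.card_le_two

lemma card_varsOf_chain (hx : 1 ≤ x) (hxy : x ≤ y) (hyn : y ≤ n) :
    (varsOf (chain posLit n x y)).card = n := by
  rw [varsOf_chain hx (by omega) (by omega) hyn]
  simp [posLit]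

lemma deficiency_chain (hx : 1 ≤ x) (hxy : x ≤ y) (hyn : y ≤ n) :
    deficiency (chain posLit n x y) = 1 := by
  have : (chain posLit n x y).card = n + 1 := by
    rw [chain, Finset.card_image_of_injOn (chainClause_injOn hx hxy hyn), Finset.card_range]
  rw [deficiency, this, card_varsOf_chain hx hxy hyn]
  push_cast
  ring

end Standard

/-- The sequence `l` with the literal `w` inserted at position `k`. -/
def insertAt (l : ℕ → Lit) (k : ℕ) (w : Lit) (i : ℕ) : Lit :=
  if i < k then l i else if i = k then w else l (i - 1)

lemma insertAt_of_lt {l : ℕ → Lit} {k i : ℕ} (w : Lit) (h : i < k) : insertAt l k w i = l i :=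
  if_pos h

lemma insertAt_self (l : ℕ → Lit) (k : ℕ) (w : Lit) : insertAt l k w k = w := by
  simp [insertAt]

lemma insertAt_succ_of_le {l : ℕ → Lit} {k i : ℕ} (w : Lit) (h : k ≤ i) :
    insertAt l k w (i + 1) = l i := by
  rw [insertAt, if_neg (by omega), if_neg (by omega), Nat.add_sub_cancel]

lemma insertAt_injOn {l : ℕ → Lit} {n k : ℕ} {w : Lit} (hk : 1 ≤ k) (hkn : k ≤ n + 1)
    (hl : Set.InjOn (fun i => (l i).1) (Set.Icc 1 n)) (hw : ∀ i ∈ Set.Icc 1 n, (l i).1 ≠ w.1) :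
    Set.InjOn (fun i => (insertAt l k w i).1) (Set.Icc 1 (n + 1)) := by
  intro a ha b hb hab
  simp only [Set.mem_Icc] at ha hb
  have hl' : ∀ i j, 1 ≤ i → i ≤ n → 1 ≤ j → j ≤ n → (l i).1 = (l j).1 → i = j :=
    fun i j h1 h2 h3 h4 h => hl ⟨h1, h2⟩ ⟨h3, h4⟩ h
  have hw' : ∀ i, 1 ≤ i → i ≤ n → (l i).1 ≠ w.1 := fun i h1 h2 => hw i ⟨h1, h2⟩
  simp only [insertAt] at hab
  split_ifs at hab
  · exact hl' a b (by omega) (by omega) (by omega) (by omega) hab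
  · exact absurd hab (hw' a (by omega) (by omega))
  · have := hl' a (b - 1) (by omega) (by omega) (by omega) (by omega) hab
    omega
  · exact absurd hab.symm (hw' b (by omega) (by omega))
  · omega
  · exact absurd hab.symm (hw' (b - 1) (by omega) (by omega))
  · have := hl' (a - 1) b (by omega) (by omega) (by omega) (by omega) hab
    omega
  · exact absurd hab (hw' (a - 1) (by omega) (by omega))
  · have := hl' (a - 1) (b - 1) (by omega) (by omega) (by omega) (by omega) hab
    omega

lemma image_range_insert {α : Type*} [DecidableEq α] {c c' : ℕ → α} {n j : ℕ} (hj : j ≤ n)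
    (hlt : ∀ i < j, c' i = c i) (hgt : ∀ i, j < i → i ≤ n → c' (i + 1) = c i) :
    (Finset.range (n + 2)).image c' =
      insert (c' j) (insert (c' (j + 1)) (((Finset.range (n + 1)).erase j).image c)) := by
  ext a
  simp only [Finset.mem_image, Finset.mem_range, Finset.mem_insert, Finset.mem_erase]
  constructor
  · rintro ⟨i, hi, rfl⟩
    rcases lt_trichotomy i j with h | rfl | h
    · exact Or.inr (Or.inr ⟨i, ⟨by omega, by omega⟩, (hlt i h).symm⟩)
    · exact Or.inl rfl
    · rcases Nat.eq_or_lt_of_le (show j + 1 ≤ i from h) with rfl | h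
      · exact Or.inr (Or.inl rfl)
      · refine Or.inr (Or.inr ⟨i - 1, ⟨by omega, by omega⟩, ?_⟩)
        rw [← hgt (i - 1) (by omega) (by omega), Nat.sub_add_cancel (by omega)]
  · rintro (rfl | rfl | ⟨i, ⟨hne, hi⟩, rfl⟩)
    · exact ⟨j, by omega, rfl⟩
    · exact ⟨j + 1, by omega, rfl⟩
    · rcases Nat.lt_or_gt_of_ne hne with h | h
      · exact ⟨i, by omega, hlt i h⟩
      · exact ⟨i + 1, by omega, hgt i h (by omega)⟩

lemma chain_insertAt {l : ℕ → Lit} {n x y x' y' j : ℕ} {w : Lit} (hj : j ≤ n)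
    (hx : j = 0 ∨ insertAt l (j + 1) w x' = l x) (hy : j = n ∨ insertAt l (j + 1) w y' = l y) :
    chain (insertAt l (j + 1) w) (n + 1) x' y' =
      insert {chainFst (insertAt l (j + 1) w) x' j, w}
        (insert {Lit.compl w, chainSnd (insertAt l (j + 1) w) (n + 1) y' (j + 1)}
          (((Finset.range (n + 1)).erase j).image (chainClause l n x y))) := by
  rw [chain, image_range_insert (c := chainClause l n x y) hj]
  · congr 2
    · rw [chainClause, chainSnd, if_neg (by omega), insertAt_self]
    · rw [chainClause, chainFst, if_neg (by omega), insertAt_self]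
  · intro i hi
    rw [chainClause, chainClause]
    congr 1
    · unfold chainFst
      split_ifs with h
      · exact hx.resolve_left (by omega)
      · rw [insertAt_of_lt _ (by omega)]
    · unfold chainSnd
      rw [if_neg (by omega), if_neg (by omega), insertAt_of_lt _ (by omega)]
  · intro i hij hin
    rw [chainClause, chainClause]
    congr 1
    · unfold chainFst
      rw [if_neg (by omega), if_neg (by omega), insertAt_succ_of_le _ (by omega)]
    · unfold chainSnd
      by_cases h : i = n
      · rw [if_pos (by omega), if_pos h, hy.resolve_left (by omega)]
      · rw [if_neg (by omega), if_neg h, insertAt_succ_of_le _ (by omega)]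

/-- `F` is a chain over `n` distinct variables with admissible branching positions. -/
def IsChainOf (n : ℕ) (F : Finset (Finset Lit)) : Prop :=
  ∃ l x y, 1 ≤ x ∧ x ≤ y ∧ y ≤ n ∧ Set.InjOn (fun i => (l i).1) (Set.Icc 1 n) ∧
    F = chain l n x y

section Extension

variable {l : ℕ → Lit} {n x y j : ℕ} {w : Lit}

lemma isChain_split (hx : 1 ≤ x) (hxy : x ≤ y) (hyn : y ≤ n)
    (hl : Set.InjOn (fun i => (l i).1) (Set.Icc 1 n)) (hj : j ≤ n)
    (hw : ∀ i ∈ Set.Icc 1 n, (l i).1 ≠ w.1) :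
    IsChainOf (n + 1) (insert {chainFst l x j, w} (insert {Lit.compl w, chainSnd l n y j}
      (((Finset.range (n + 1)).erase j).image (chainClause l n x y)))) := by
  have hup : ∀ z, insertAt l (j + 1) w (if z ≤ j then z else z + 1) = l z := by
    intro z
    split_ifs with h
    · exact insertAt_of_lt _ (by omega)
    · exact insertAt_succ_of_le _ (by omega)
  refine ⟨insertAt l (j + 1) w, if x ≤ j then x else x + 1, if y ≤ j then y else y + 1,
    by split_ifs <;> omega, by split_ifs <;> omega, by split_ifs <;> omega,
    insertAt_injOn (by omega) (by omega) hl hw, ?_⟩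
  rw [chain_insertAt (x := x) (y := y) hj (Or.inr (hup x)) (Or.inr (hup y))]
  congr 2
  · unfold chainFst
    rw [hup]
    split_ifs
    · rfl
    · rw [insertAt_of_lt _ (by omega)]
  · unfold chainSnd
    rw [hup]
    by_cases h : j = n
    · rw [if_pos h, if_pos (by omega)]
    · rw [if_neg h, if_neg (by omega), insertAt_succ_of_le _ (by omega)]

lemma isChain_split_first (hy : 1 ≤ y) (hyn : y ≤ n)
    (hl : Set.InjOn (fun i => (l i).1) (Set.Icc 1 n))
    (hw : ∀ i ∈ Set.Icc 1 n, (l i).1 ≠ w.1) :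
    IsChainOf (n + 1) (insert {w} (insert {Lit.compl w, l 1}
      (((Finset.range (n + 1)).erase 0).image (chainClause l n x y)))) := by
  refine ⟨insertAt l 1 w, 1, y + 1, le_rfl, by omega, by omega,
    insertAt_injOn (by omega) (by omega) hl hw, ?_⟩
  rw [chain_insertAt (x := x) (y := y) (by omega) (Or.inl rfl)
    (Or.inr (insertAt_succ_of_le _ (by omega)))]
  congr 2
  · simp [chainFst, insertAt_self]
  · rw [chainSnd, if_neg (by omega), insertAt_succ_of_le _ (by omega)]

lemma isChain_split_last (hx : 1 ≤ x) (hxn : x ≤ n)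
    (hl : Set.InjOn (fun i => (l i).1) (Set.Icc 1 n))
    (hw : ∀ i ∈ Set.Icc 1 n, (l i).1 ≠ w.1) :
    IsChainOf (n + 1) (insert {Lit.compl (l n), w} (insert {Lit.compl w}
      (((Finset.range (n + 1)).erase n).image (chainClause l n x y)))) := by
  refine ⟨insertAt l (n + 1) w, x, n + 1, hx, by omega, le_rfl,
    insertAt_injOn (by omega) (by omega) hl hw, ?_⟩
  rw [chain_insertAt (x := x) (y := y) le_rfl (Or.inr (insertAt_of_lt _ (by omega)))
    (Or.inl rfl)]
  congr 2
  · rw [chainFst, if_neg (by omega), insertAt_of_lt _ (by omega)]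
  · simp [chainSnd, insertAt_self]

lemma isChain_split_unit (hx : 1 ≤ x) (hxy : x ≤ y) (hyn : y ≤ n)
    (hl : Set.InjOn (fun i => (l i).1) (Set.Icc 1 n)) (hj : j ≤ n)
    (hw : ∀ i ∈ Set.Icc 1 n, (l i).1 ≠ w.1) {p : Lit} (hp : chainFst l x j = p)
    (hp' : chainSnd l n y j = p) :
    IsChainOf (n + 1) (insert {w} (insert {Lit.compl w, p}
      (((Finset.range (n + 1)).erase j).image (chainClause l n x y)))) := by
  unfold chainFst at hp
  unfold chainSnd at hp'
  split_ifs at hp hp' with h0 hn hn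
  · omega
  · subst h0
    rw [← hp']
    exact isChain_split_first (by omega) hyn hl hw
  · subst hn
    have := isChain_split_last (y := y) (w := Lit.compl w) hx (by omega) hl hw
    rwa [Lit.compl_compl, hp, Finset.pair_comm, Finset.insert_comm] at this
  · have hv : (l j).1 = (l (j + 1)).1 := by rw [hp', ← hp, Lit.compl_fst]
    have := hl ⟨by omega, hj⟩ ⟨by omega, by omega⟩ hv
    omega

lemma isChain_of_resolvent (hx : 1 ≤ x) (hxy : x ≤ y) (hyn : y ≤ n)
    (hl : Set.InjOn (fun i => (l i).1) (Set.Icc 1 n)) (hj : j ≤ n)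
    (hw : ∀ i ∈ Set.Icc 1 n, (l i).1 ≠ w.1) {A B : Finset Lit} (hA : A.card ≤ 1)
    (hB : B.card ≤ 1) (hAB : A ∪ B = chainClause l n x y j) :
    IsChainOf (n + 1) (insert (insert w A) (insert (insert (Lit.compl w) B)
      (((Finset.range (n + 1)).erase j).image (chainClause l n x y)))) := by
  rw [chainClause] at hAB
  obtain ⟨a, ha⟩ := Finset.card_le_one_iff_subset_singleton.1 hA
  obtain ⟨b, hb⟩ := Finset.card_le_one_iff_subset_singleton.1 hB
  have hp : chainFst l x j ∈ A ∪ B := hAB ▸ Finset.mem_insert_self _ _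
  have hq : chainSnd l n y j ∈ A ∪ B :=
    hAB ▸ Finset.mem_insert_of_mem (Finset.mem_singleton_self _)
  rcases Finset.subset_singleton_iff.1 ha with rfl | rfl <;>
    rcases Finset.subset_singleton_iff.1 hb with rfl | rfl
  · simp at hp
  · exact isChain_split_unit hx hxy hyn hl hj hw (by simpa using hp) (by simpa using hq)
  · have := isChain_split_unit (w := Lit.compl w) hx hxy hyn hl hj hw
      (p := a) (by simpa using hp) (by simpa using hq)
    rwa [Lit.compl_compl, Finset.insert_comm] at this
  · have hpair : ({a, b} : Finset Lit) = {chainFst l x j, chainSnd l n y j} := hAB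
    have hset : ({a, b} : Set Lit) = {chainFst l x j, chainSnd l n y j} := by
      rw [← Finset.coe_pair, ← Finset.coe_pair, hpair]
    rcases Set.pair_eq_pair_iff.1 hset with ⟨rfl, rfl⟩ | ⟨rfl, rfl⟩
    · have := isChain_split hx hxy hyn hl hj hw
      rwa [Finset.pair_comm] at this
    · have := isChain_split (w := Lit.compl w) hx hxy hyn hl hj hw
      rwa [Lit.compl_compl, Finset.insert_comm, Finset.pair_comm _ (Lit.compl w)] at this

end Extension

lemma MU.sat_erase {F : Finset (Finset Lit)} (h : MU F) {C : Finset Lit} (hC : C ∈ F) :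
    ∃ φ, ∀ D ∈ F, D ≠ C → Satisfies φ D := by
  obtain ⟨φ, hφ⟩ := h.2.2 (F.erase C) (Finset.erase_ssubset hC)
  exact ⟨φ, fun D hD hDC => hφ D (Finset.mem_erase.2 ⟨hDC, hD⟩)⟩

lemma MU.exists_unsatisfied {F : Finset (Finset Lit)} (h : MU F) (φ : ℕ → Bool) :
    ∃ C ∈ F, ¬ Satisfies φ C := by
  by_contra! hφ
  exact h.2.1 ⟨φ, hφ⟩

lemma MU.empty_notMem {F : Finset (Finset Lit)} (h : MU F) (hF : (varsOf F).Nonempty) :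
    ∅ ∉ F := by
  intro hmem
  obtain ⟨v, hv⟩ := hF
  obtain ⟨C, hC, q, hq, -⟩ := mem_varsOf.1 hv
  obtain ⟨φ, hφ⟩ := h.sat_erase hC
  obtain ⟨x, hx, -⟩ := hφ ∅ hmem (Finset.ne_empty_of_mem hq).symm
  simp at hx

lemma MU.exists_mem {F : Finset (Finset Lit)} (h : MU F) {p : Lit} (hp : p ∈ litsOf F) :
    ∃ C ∈ F, p ∈ C := by
  by_contra! hno
  obtain ⟨C, hC, q, hq, hqp⟩ := mem_varsOf.1 (mem_litsOf.1 hp)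
  have hCp : Lit.compl p ∈ C := by
    rcases Lit.eq_or_eq_compl hqp with rfl | rfl
    · exact absurd hq (hno C hC)
    · exact hq
  obtain ⟨φ, hφ⟩ := h.sat_erase hC
  obtain ⟨D, hD, hDn⟩ := h.exists_unsatisfied (makeTrue φ (Lit.compl p))
  refine hDn ?_
  by_cases hDC : D = C
  · exact ⟨Lit.compl p, hDC ▸ hCp, litVal_makeTrue_self _ _⟩
  · exact (hφ D hD hDC).makeTrue (by rw [Lit.compl_compl]; exact hno D hD)

lemma MU.one_le_ldeg {F : Finset (Finset Lit)} (h : MU F) {p : Lit} (hp : p ∈ litsOf F) :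
    1 ≤ ldeg F p := by
  obtain ⟨C, hC, hpC⟩ := h.exists_mem hp
  exact Finset.card_pos.2 ⟨C, Finset.mem_filter.2 ⟨hC, hpC⟩⟩

lemma sum_card_eq_sum_vdeg (F : Finset (Finset Lit)) :
    ∑ C ∈ F, C.card = ∑ v ∈ varsOf F, vdeg F v := by
  have h := Finset.sum_card_bipartiteAbove_eq_sum_card_bipartiteBelow (s := F) (t := litsOf F)
    (fun C p => p ∈ C)
  have h1 : ∀ C ∈ F, Finset.bipartiteAbove (fun C p => p ∈ C) (litsOf F) C = C := by
    intro C hC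
    ext p
    simp only [Finset.mem_bipartiteAbove, and_iff_right_iff_imp]
    exact fun hp => subset_litsOf hC hp
  rw [Finset.sum_congr rfl fun C hC => by rw [h1 C hC]] at h
  rw [h, litsOf, Finset.sum_product]
  refine Finset.sum_congr rfl fun v _ => ?_
  rw [Fintype.sum_bool]
  rfl

lemma IsClause.fst_injOn {C : Finset Lit} (h : IsClause C) : Set.InjOn Prod.fst (C : Set Lit) := by
  intro p hp q hq hpq
  rcases Lit.eq_or_eq_compl hpq with h' | rfl
  · exact h'
  · exact absurd hp (h q hq)

lemma ldeg_eq_one_iff {F : Finset (Finset Lit)} {p : Lit} :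
    ldeg F p = 1 ↔ ∃ C ∈ F, p ∈ C ∧ ∀ D ∈ F, p ∈ D → D = C := by
  rw [ldeg, Finset.card_eq_one]
  constructor
  · rintro ⟨C, hC⟩
    have := Finset.mem_filter.1 (hC ▸ Finset.mem_singleton_self C)
    exact ⟨C, this.1, this.2, fun D hD hpD =>
      Finset.mem_singleton.1 (hC ▸ Finset.mem_filter.2 ⟨hD, hpD⟩)⟩
  · rintro ⟨C, hC, hpC, huniq⟩
    refine ⟨C, Finset.eq_singleton_iff_unique_mem.2 ⟨Finset.mem_filter.2 ⟨hC, hpC⟩, ?_⟩⟩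
    intro D hD
    exact huniq D (Finset.mem_filter.1 hD).1 (Finset.mem_filter.1 hD).2

/-- If every clause contains `p` or its complement, an only clause containing `p` is a unit. -/
lemma MU.card_le_one_of_full {F : Finset (Finset Lit)} (h : MU F) {p : Lit}
    (hfull : ∀ C ∈ F, p ∈ C ∨ Lit.compl p ∈ C) {C : Finset Lit} (hC : C ∈ F) (hp : p ∈ C)
    (huniq : ∀ D ∈ F, p ∈ D → D = C) : C.card ≤ 1 := by
  by_contra! hcard
  obtain ⟨q, hq, hqp⟩ := Finset.exists_mem_ne hcard p
  have hv : q.1 ≠ p.1 := fun hv => hqp ((h.1 C hC).fst_injOn hq hp hv)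
  obtain ⟨D, hD, hDn⟩ :=
    h.exists_unsatisfied (makeTrue (makeTrue (fun _ => true) q) (Lit.compl p))
  refine hDn ?_
  rcases hfull D hD with hpD | hpD
  · rw [huniq D hD hpD]
    refine ⟨q, hq, ?_⟩
    rw [litVal_makeTrue_of_ne _ (by rwa [Lit.compl_fst]), litVal_makeTrue_self]
  · exact ⟨_, hpD, litVal_makeTrue_self _ _⟩

lemma MU2.exists_ldeg_one {F : Finset (Finset Lit)} (h : MU2 F) (hd : deficiency F = 1)
    (hF : (varsOf F).Nonempty) :
    ∃ v, ldeg F (v, true) = 1 ∧ ldeg F (v, false) = 1 := by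
  by_contra! hno
  have hpos : ∀ v ∈ varsOf F, ∀ b, 1 ≤ ldeg F (v, b) :=
    fun v hv b => h.1.one_le_ldeg (mem_litsOf.2 hv)
  have h3 : ∀ v ∈ varsOf F, 3 ≤ vdeg F v := by
    intro v hv
    have h1 := hpos v hv true
    have h2 := hpos v hv false
    have h4 := hno v
    unfold vdeg
    omega
  have hcard : F.card = (varsOf F).card + 1 := by
    unfold deficiency at hd
    omega
  have hvars : ∀ C ∈ F, C.card ≤ (varsOf F).card := fun C hC => by
    rw [← Finset.card_image_of_injOn (h.1.1 C hC).fst_injOn]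
    exact Finset.card_le_card fun v hv => by
      obtain ⟨q, hq, rfl⟩ := Finset.mem_image.1 hv
      exact fst_mem_varsOf hC hq
  have hsum := sum_card_eq_sum_vdeg F
  have hlow : (varsOf F).card * 3 ≤ ∑ v ∈ varsOf F, vdeg F v := by
    simpa using Finset.card_nsmul_le_sum _ _ 3 h3
  have hup : ∑ C ∈ F, C.card ≤ F.card * 2 := by
    simpa using Finset.sum_le_card_nsmul _ _ 2 h.2
  have hup' : ∑ C ∈ F, C.card ≤ F.card * (varsOf F).card := by
    simpa using Finset.sum_le_card_nsmul _ _ _ hvars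
  have hn := hF.card_pos
  have hn2 : (varsOf F).card = 2 := by
    rcases Nat.lt_or_ge 1 (varsOf F).card with h1 | h1
    · omega
    · have : (varsOf F).card = 1 := by omega
      rw [this] at hlow hcard hup'
      omega
  have hC2 : ∀ C ∈ F, C.card = 2 := by
    refine (Finset.sum_eq_sum_iff_of_le h.2).1 ?_
    rw [Finset.sum_const, smul_eq_mul]
    omega
  have hV3 : ∀ v ∈ varsOf F, 3 = vdeg F v := by
    refine (Finset.sum_eq_sum_iff_of_le h3).1 ?_
    rw [Finset.sum_const, smul_eq_mul]
    omega
  obtain ⟨v, hv⟩ := hF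
  obtain ⟨b, hb⟩ : ∃ b, ldeg F (v, b) = 1 := by
    have h1 := hpos v hv true
    have h2 := hpos v hv false
    have h4 := hV3 v hv
    unfold vdeg at h4
    rcases Nat.lt_or_ge 1 (ldeg F (v, true)) with h5 | h5
    · exact ⟨false, by omega⟩
    · exact ⟨true, by omega⟩
  obtain ⟨C, hC, hpC, huniq⟩ := ldeg_eq_one_iff.1 hb
  have := h.1.card_le_one_of_full (p := (v, b)) (fun D hD => ?_) hC hpC huniq
  · rw [hC2 C hC] at this
    omega
  · have hDimg : D.image Prod.fst = varsOf F := by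
      refine Finset.eq_of_subset_of_card_le (fun w hw => ?_) ?_
      · obtain ⟨q, hq, rfl⟩ := Finset.mem_image.1 hw
        exact fst_mem_varsOf hD hq
      · rw [Finset.card_image_of_injOn (h.1.1 D hD).fst_injOn, hC2 D hD, hn2]
    rw [← hDimg] at hv
    obtain ⟨q, hq, hqv⟩ := Finset.mem_image.1 hv
    rcases Lit.eq_or_eq_compl (p := q) (q := (v, b)) hqv with rfl | rfl
    · exact Or.inl hq
    · exact Or.inr hq

section Resolution

variable {A B : Finset Lit} {R : Finset (Finset Lit)} {u : Lit}

/-- The literal `u` and its complement occur in `F` only in the clauses `A ∪ {u}` and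
`B ∪ {ū}`. -/
structure SplitsAs (F : Finset (Finset Lit)) (u : Lit) (A B : Finset Lit)
    (R : Finset (Finset Lit)) : Prop where
  eq : F = insert (insert u A) (insert (insert (Lit.compl u) B) R)
  fst_left : ∀ q ∈ A, q.1 ≠ u.1
  fst_right : ∀ q ∈ B, q.1 ≠ u.1
  fst_rest : ∀ D ∈ R, ∀ q ∈ D, q.1 ≠ u.1

lemma MU.exists_splitsAs {F : Finset (Finset Lit)} (h : MU F) {v : ℕ}
    (ht : ldeg F (v, true) = 1) (hf : ldeg F (v, false) = 1) :
    ∃ A B R, SplitsAs F (v, true) A B R := by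
  obtain ⟨P, hP, hvP, hPu⟩ := ldeg_eq_one_iff.1 ht
  obtain ⟨Q, hQ, hvQ, hQu⟩ := ldeg_eq_one_iff.1 hf
  have hPQ : Q ≠ P := by
    rintro rfl
    exact h.1 Q hP _ hvP hvQ
  refine ⟨P.erase (v, true), Q.erase (v, false), (F.erase P).erase Q, ?_, ?_, ?_, ?_⟩
  · rw [Finset.insert_erase hvP, show Lit.compl (v, true) = (v, false) from rfl,
      Finset.insert_erase hvQ, Finset.insert_erase (Finset.mem_erase.2 ⟨hPQ, hQ⟩),
      Finset.insert_erase hP]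
  · intro q hq hqv
    rw [Finset.mem_erase] at hq
    exact hq.1 ((h.1 P hP).fst_injOn hq.2 hvP hqv)
  · intro q hq hqv
    rw [Finset.mem_erase] at hq
    exact hq.1 ((h.1 Q hQ).fst_injOn hq.2 hvQ hqv)
  · intro D hD q hq hqv
    simp only [Finset.mem_erase] at hD
    rcases Lit.eq_or_eq_compl (p := q) (q := (v, true)) hqv with rfl | rfl
    · exact hD.2.1 (hPu D hD.2.2 hq)
    · exact hD.1 (hQu D hD.2.2 hq)

variable {F : Finset (Finset Lit)}

lemma satisfies_insert_iff {φ : ℕ → Bool} {C : Finset Lit} :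
    Satisfies φ (insert u C) ↔ LitVal φ u = true ∨ Satisfies φ C := by
  simp [Satisfies]

lemma satisfies_union {φ : ℕ → Bool} :
    Satisfies φ (A ∪ B) ↔ Satisfies φ A ∨ Satisfies φ B := by
  simp [Satisfies, or_and_right, exists_or]

lemma SplitsAs.left_mem (hs : SplitsAs F u A B R) : insert u A ∈ F := by
  rw [hs.eq]
  exact Finset.mem_insert_self _ _

lemma SplitsAs.right_mem (hs : SplitsAs F u A B R) : insert (Lit.compl u) B ∈ F := by
  rw [hs.eq]
  exact Finset.mem_insert_of_mem (Finset.mem_insert_self _ _)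

lemma SplitsAs.rest_subset (hs : SplitsAs F u A B R) : R ⊆ F := by
  rw [hs.eq]
  exact (Finset.subset_insert _ _).trans (Finset.subset_insert _ _)

lemma SplitsAs.left_notMem (hs : SplitsAs F u A B R) : insert u A ∉ R :=
  fun h => hs.fst_rest _ h u (Finset.mem_insert_self _ _) rfl

lemma SplitsAs.right_notMem (hs : SplitsAs F u A B R) : insert (Lit.compl u) B ∉ R :=
  fun h => hs.fst_rest _ h _ (Finset.mem_insert_self _ _) (Lit.compl_fst u)

lemma SplitsAs.left_ne_right (hs : SplitsAs F u A B R) :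
    insert u A ≠ insert (Lit.compl u) B := by
  intro h
  have : u ∈ insert (Lit.compl u) B := h ▸ Finset.mem_insert_self _ _
  rcases Finset.mem_insert.1 this with h | h
  · exact Lit.compl_ne u h.symm
  · exact hs.fst_right u h rfl

lemma satisfies_makeTrue_of_fst_ne {φ : ℕ → Bool} {C : Finset Lit}
    (hC : ∀ q ∈ C, q.1 ≠ u.1) (h : Satisfies φ C) : Satisfies (makeTrue φ u) C :=
  h.makeTrue fun hu => hC _ hu (Lit.compl_fst u)

lemma SplitsAs.sat (hs : SplitsAs F u A B R) {φ : ℕ → Bool} (hR : ∀ D ∈ R, Satisfies φ D)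
    (hAB : Satisfies φ (A ∪ B)) : Sat F := by
  rcases satisfies_union.1 hAB with hA | hB
  · refine ⟨makeTrue φ (Lit.compl u), fun D hD => ?_⟩
    change Satisfies _ D
    rw [hs.eq, Finset.mem_insert, Finset.mem_insert] at hD
    rcases hD with rfl | rfl | hD
    · exact satisfies_insert_iff.2 (Or.inr (satisfies_makeTrue_of_fst_ne hs.fst_left hA))
    · exact satisfies_insert_iff.2 (Or.inl (litVal_makeTrue_self _ _))
    · exact satisfies_makeTrue_of_fst_ne (hs.fst_rest D hD) (hR D hD)
  · refine ⟨makeTrue φ u, fun D hD => ?_⟩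
    change Satisfies _ D
    rw [hs.eq, Finset.mem_insert, Finset.mem_insert] at hD
    rcases hD with rfl | rfl | hD
    · exact satisfies_insert_iff.2 (Or.inl (litVal_makeTrue_self _ _))
    · exact satisfies_insert_iff.2 (Or.inr (satisfies_makeTrue_of_fst_ne hs.fst_right hB))
    · exact satisfies_makeTrue_of_fst_ne (hs.fst_rest D hD) (hR D hD)

lemma SplitsAs.rest_sat (hs : SplitsAs F u A B R) (h : MU F) :
    ∃ φ, ∀ D ∈ R, Satisfies φ D := by
  obtain ⟨φ, hφ⟩ := h.sat_erase hs.left_mem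
  exact ⟨φ, fun D hD => hφ D (hs.rest_subset hD) fun he => hs.left_notMem (he ▸ hD)⟩

lemma satisfies_resolvent {φ : ℕ → Bool} (hA : Satisfies φ (insert u A))
    (hB : Satisfies φ (insert (Lit.compl u) B)) : Satisfies φ (A ∪ B) := by
  rw [satisfies_insert_iff] at hA hB
  rw [litVal_compl] at hB
  rw [satisfies_union]
  cases hu : LitVal φ u <;> simp_all

lemma SplitsAs.union_notMem (hs : SplitsAs F u A B R) (h : MU F) : A ∪ B ∉ R := by
  intro hmem
  obtain ⟨φ, hφ⟩ := hs.rest_sat h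
  exact h.2.1 (hs.sat hφ (hφ _ hmem))

lemma SplitsAs.isClause_union (hs : SplitsAs F u A B R) (h : MU F) : IsClause (A ∪ B) := by
  intro p hp hp'
  obtain ⟨φ, hφ⟩ := hs.rest_sat h
  refine h.2.1 (hs.sat hφ ?_)
  cases hv : LitVal φ p
  · exact ⟨_, hp', by rw [litVal_compl, hv]; rfl⟩
  · exact ⟨p, hp, hv⟩

lemma SplitsAs.mu (hs : SplitsAs F u A B R) (h : MU F) : MU (insert (A ∪ B) R) := by
  refine ⟨?_, ?_, ?_⟩
  · intro C hC
    rcases Finset.mem_insert.1 hC with rfl | hC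
    · exact hs.isClause_union h
    · exact h.1 C (hs.rest_subset hC)
  · rintro ⟨φ, hφ⟩
    exact h.2.1 (hs.sat (fun D hD => hφ D (Finset.mem_insert_of_mem hD))
      (hφ _ (Finset.mem_insert_self _ _)))
  · intro G hG
    obtain ⟨C, hC, hCG⟩ := Finset.exists_of_ssubset hG
    rcases Finset.mem_insert.1 hC with rfl | hC
    · obtain ⟨φ, hφ⟩ := hs.rest_sat h
      refine ⟨φ, fun D hD => ?_⟩
      rcases Finset.mem_insert.1 (hG.subset hD) with rfl | hD'
      · exact absurd hD hCG
      · exact hφ D hD'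
    · obtain ⟨φ, hφ⟩ := h.sat_erase (hs.rest_subset hC)
      refine ⟨φ, fun D hD => ?_⟩
      rcases Finset.mem_insert.1 (hG.subset hD) with rfl | hD'
      · exact satisfies_resolvent
          (hφ _ hs.left_mem fun he => hs.left_notMem (he ▸ hC))
          (hφ _ hs.right_mem fun he => hs.right_notMem (he ▸ hC))
      · exact hφ D (hs.rest_subset hD') fun he => hCG (he ▸ hD)

lemma SplitsAs.card_left (hs : SplitsAs F u A B R) (h : MU2 F) : A.card ≤ 1 := by
  have := h.2 _ hs.left_mem
  rw [Finset.card_insert_of_notMem fun hu => hs.fst_left u hu rfl] at this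
  omega

lemma SplitsAs.card_right (hs : SplitsAs F u A B R) (h : MU2 F) : B.card ≤ 1 := by
  have := h.2 _ hs.right_mem
  rw [Finset.card_insert_of_notMem fun hu => hs.fst_right _ hu (Lit.compl_fst u)] at this
  omega

lemma SplitsAs.mu2 (hs : SplitsAs F u A B R) (h : MU2 F) : MU2 (insert (A ∪ B) R) := by
  refine ⟨hs.mu h.1, fun C hC => ?_⟩
  rcases Finset.mem_insert.1 hC with rfl | hC
  · have h1 := hs.card_left h
    have h2 := hs.card_right h
    have h3 := Finset.card_union_le A B
    omega
  · exact h.2 C (hs.rest_subset hC)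

lemma varsOf_insert (C : Finset Lit) (G : Finset (Finset Lit)) :
    varsOf (insert C G) = C.image Prod.fst ∪ varsOf G :=
  Finset.biUnion_insert

lemma SplitsAs.varsOf_eq (hs : SplitsAs F u A B R) :
    varsOf F = insert u.1 (varsOf (insert (A ∪ B) R)) := by
  simp only [hs.eq, varsOf_insert, Finset.image_insert, Finset.image_union, Lit.compl_fst]
  ext v
  simp only [Finset.mem_union, Finset.mem_insert]
  tauto

lemma SplitsAs.fst_notMem (hs : SplitsAs F u A B R) : u.1 ∉ varsOf (insert (A ∪ B) R) := by
  intro hu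
  obtain ⟨C, hC, q, hq, hqu⟩ := mem_varsOf.1 hu
  rcases Finset.mem_insert.1 hC with rfl | hC
  · exact (Finset.mem_union.1 hq).elim (fun h => hs.fst_left q h hqu)
      (fun h => hs.fst_right q h hqu)
  · exact hs.fst_rest C hC q hq hqu

lemma SplitsAs.card_varsOf (hs : SplitsAs F u A B R) :
    (varsOf F).card = (varsOf (insert (A ∪ B) R)).card + 1 := by
  rw [hs.varsOf_eq, Finset.card_insert_of_notMem hs.fst_notMem]

lemma SplitsAs.card_eq (hs : SplitsAs F u A B R) (h : MU F) :
    F.card = (insert (A ∪ B) R).card + 1 := by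
  have hne : insert u A ∉ insert (insert (Lit.compl u) B) R := by
    simp only [Finset.mem_insert, not_or]
    exact ⟨hs.left_ne_right, hs.left_notMem⟩
  conv_lhs => rw [hs.eq]
  rw [Finset.card_insert_of_notMem hne, Finset.card_insert_of_notMem hs.right_notMem,
    Finset.card_insert_of_notMem (hs.union_notMem h)]

lemma SplitsAs.deficiency_eq (hs : SplitsAs F u A B R) (h : MU F) :
    deficiency (insert (A ∪ B) R) = deficiency F := by
  rw [deficiency, deficiency, hs.card_eq h, hs.card_varsOf]
  push_cast
  ring

lemma SplitsAs.isChainOf (hs : SplitsAs F u A B R) (h : MU2 F) {n : ℕ}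
    (hd : deficiency F = 1) (hn : (varsOf F).card = n + 1)
    (hc : IsChainOf n (insert (A ∪ B) R)) : IsChainOf (n + 1) F := by
  obtain ⟨l, x, y, hx, hxy, hyn, hl, heq⟩ := hc
  obtain ⟨j, hj, hjAB⟩ := mem_chain.1 (heq ▸ Finset.mem_insert_self (A ∪ B) R)
  have hvars : varsOf (insert (A ∪ B) R) = (Finset.Icc 1 n).image fun i => (l i).1 := by
    rw [heq, varsOf_chain hx (by omega) (by omega) hyn]
  have hinj : Set.InjOn (chainClause l n x y) ↑(Finset.range (n + 1)) := by
    refine Finset.card_image_iff.1 ?_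
    rw [← chain, ← heq, Finset.card_range]
    have h1 := hs.card_eq h.1
    unfold deficiency at hd
    omega
  have hR : R = ((Finset.range (n + 1)).erase j).image (chainClause l n x y) := by
    rw [← Finset.erase_insert (hs.union_notMem h.1), heq]
    ext C
    simp only [Finset.mem_erase, Finset.mem_image, mem_chain, Finset.mem_range]
    constructor
    · rintro ⟨hne, i, hi, rfl⟩
      exact ⟨i, ⟨fun hij => hne (by rw [hij, hjAB]), by omega⟩, rfl⟩
    · rintro ⟨i, ⟨hij, hi⟩, rfl⟩
      refine ⟨fun he => hij (hinj (by simpa using hi) (by simpa using Nat.lt_succ_of_le hj) ?_),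
        i, by omega, rfl⟩
      rw [he, hjAB]
  rw [hs.eq, hR]
  refine isChain_of_resolvent hx hxy hyn hl hj (fun i hi he => hs.fst_notMem ?_)
    (hs.card_left h) (hs.card_right h) hjAB.symm
  rw [hvars, ← he]
  exact Finset.mem_image_of_mem _ (Finset.mem_Icc.2 hi)

lemma SplitsAs.isChainOf_one (hs : SplitsAs F u A B R) (h : MU F)
    (hempty : varsOf (insert (A ∪ B) R) = ∅) : IsChainOf 1 F := by
  have hnil : ∀ C ∈ insert (A ∪ B) R, C = ∅ := by
    intro C hC
    refine Finset.eq_empty_of_forall_notMem fun q hq => ?_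
    have := fst_mem_varsOf hC hq
    simp [hempty] at this
  have hR : R = ∅ := by
    refine Finset.eq_empty_of_forall_notMem fun C hC => ?_
    have hCe := hnil C (Finset.mem_insert_of_mem hC)
    have hF : (varsOf F).Nonempty := by
      rw [hs.varsOf_eq]
      exact Finset.insert_nonempty _ _
    exact h.empty_notMem hF (hCe ▸ hs.rest_subset hC)
  have hAB := Finset.union_eq_empty.1 (hnil _ (Finset.mem_insert_self _ _))
  refine ⟨fun _ => u, 1, 1, le_rfl, le_rfl, le_rfl, by simp, ?_⟩
  rw [hs.eq, hR, hAB.1, hAB.2]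
  simp [chain, chainClause, chainFst, chainSnd, Finset.range_add_one, Finset.pair_comm]

end Resolution

lemma MU2.isChainOf {n : ℕ} (hn : 1 ≤ n) {F : Finset (Finset Lit)} (h : MU2 F)
    (hd : deficiency F = 1) (hF : (varsOf F).card = n) : IsChainOf n F := by
  induction n, hn using Nat.le_induction generalizing F with
  | base =>
    obtain ⟨v, ht, hf⟩ := h.exists_ldeg_one hd (Finset.card_pos.1 (by omega))
    obtain ⟨A, B, R, hs⟩ := h.1.exists_splitsAs ht hf
    refine hs.isChainOf_one h.1 (Finset.card_eq_zero.1 ?_)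
    have := hs.card_varsOf
    omega
  | succ n hn ih =>
    obtain ⟨v, ht, hf⟩ := h.exists_ldeg_one hd (Finset.card_pos.1 (by omega))
    obtain ⟨A, B, R, hs⟩ := h.1.exists_splitsAs ht hf
    refine hs.isChainOf h hd hF (ih (hs.mu2 h) (by rw [hs.deficiency_eq h.1, hd]) ?_)
    have := hs.card_varsOf
    omega

lemma IsChainOf.exists_cnfIso {n : ℕ} {F : Finset (Finset Lit)} (h : IsChainOf n F) :
    ∃ x y f, 1 ≤ x ∧ x ≤ y ∧ x + y ≤ n + 1 ∧ CNFIso (chain posLit n x y) F f := by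
  obtain ⟨l, x, y, hx, hxy, hyn, hl, rfl⟩ := h
  by_cases hsum : x + y ≤ n + 1
  · exact ⟨x, y, _, hx, hxy, hsum, cnfIso_chain hx (by omega) (by omega) hyn hl⟩
  · refine ⟨n + 1 - y, n + 1 - x, substLit fun i => Lit.compl (l (n + 1 - i)),
      by omega, by omega, by omega, ?_⟩
    rw [chain_reverse hx (by omega) (by omega) hyn]
    refine cnfIso_chain (by omega) (by omega) (by omega) (by omega) fun a ha b hb hab => ?_
    simp only [Set.mem_Icc] at ha hb
    have := hl (show n + 1 - a ∈ Set.Icc 1 n from ⟨by omega, by omega⟩)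
      (show n + 1 - b ∈ Set.Icc 1 n from ⟨by omega, by omega⟩) hab
    omega

/-- The parameters of the normal forms with `n` variables. -/
def normalParams (n : ℕ) : Finset (Σ _ : ℕ, ℕ) :=
  (Finset.Icc 1 ((n + 1) / 2)).sigma fun x => Finset.Icc x (n + 1 - x)

lemma mem_normalParams {n : ℕ} {p : Σ _ : ℕ, ℕ} :
    p ∈ normalParams n ↔ 1 ≤ p.1 ∧ p.1 ≤ p.2 ∧ p.1 + p.2 ≤ n + 1 := by
  simp only [normalParams, Finset.mem_sigma, Finset.mem_Icc]
  omega

lemma card_normalParams (n : ℕ) :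
    (normalParams n).card = (n + 1) / 2 * (n + 1 - (n + 1) / 2) := by
  have key : ∀ m, 2 * m ≤ n + 1 →
      ∑ x ∈ Finset.Icc 1 m, (n + 1 - x + 1 - x) = m * (n + 1 - m) := by
    intro m
    induction m with
    | zero => simp
    | succ m ih =>
      intro hm
      rw [Finset.sum_Icc_succ_top (by omega), ih (by omega)]
      obtain ⟨k, hk⟩ : ∃ k, n + 1 = 2 * (m + 1) + k := ⟨n + 1 - 2 * (m + 1), by omega⟩
      rw [hk, show 2 * (m + 1) + k - m = m + 2 + k by omega,
        show 2 * (m + 1) + k - (m + 1) + 1 - (m + 1) = k + 1 by omega,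
        show 2 * (m + 1) + k - (m + 1) = m + 1 + k by omega]
      ring
  rw [normalParams, Finset.card_sigma]
  simp only [Nat.card_Icc]
  exact key _ (by omega)

/-- The normal form with parameters `p`. -/
def normalForm (n : ℕ) (p : normalParams n) : MU2dn 1 n :=
  have h := mem_normalParams.1 p.2
  ⟨chain posLit n p.1.1 p.1.2, chain_mu2 h.1 h.2.1 (by omega),
    deficiency_chain h.1 h.2.1 (by omega), card_varsOf_chain h.1 h.2.1 (by omega)⟩

lemma normalForm_bijective {n : ℕ} (hn : 1 ≤ n) :
    Function.Bijective fun p => Quot.mk (@isoRel 1 n) (normalForm n p) := by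
  constructor
  · intro p q hpq
    have hp := mem_normalParams.1 p.2
    have hq := mem_normalParams.1 q.2
    have h1 := congrArg (Quot.lift (fun F : MU2dn 1 n => minEssential F.1)
      fun _ _ ⟨_, hf⟩ => hf.minEssential_eq) hpq
    have h2 := congrArg (Quot.lift (fun F : MU2dn 1 n => determinedCount F.1)
      fun _ _ ⟨_, hf⟩ => hf.determinedCount_eq) hpq
    change minEssential (chain posLit n p.1.1 p.1.2) =
      minEssential (chain posLit n q.1.1 q.1.2) at h1
    change determinedCount (chain posLit n p.1.1 p.1.2) =
      determinedCount (chain posLit n q.1.1 q.1.2) at h2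
    rw [minEssential_chain hp.1 hp.2.1 hp.2.2, minEssential_chain hq.1 hq.2.1 hq.2.2] at h1
    rw [determinedCount_chain hp.1 hp.2.1 (by omega),
      determinedCount_chain hq.1 hq.2.1 (by omega)] at h2
    exact Subtype.ext (Sigma.ext h1 (heq_of_eq (by omega)))
  · rintro ⟨F⟩
    obtain ⟨x, y, f, hx, hxy, hsum, hf⟩ :=
      (F.2.1.isChainOf hn F.2.2.1 F.2.2.2).exists_cnfIso
    exact ⟨⟨⟨x, y⟩, mem_normalParams.2 ⟨hx, hxy, hsum⟩⟩, Quot.sound ⟨f, hf⟩⟩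

theorem stmt19 (n : ℕ) (hn : 1 ≤ n) :
    numClasses (1 : ℤ) n = if Even n then n * (n + 2) / 4 else (n + 1) ^ 2 / 4 := by
  rw [numClasses, ← Nat.card_congr (Equiv.ofBijective _ (normalForm_bijective hn)),
    Nat.card_eq_fintype_card, Fintype.card_coe, card_normalParams]
  split_ifs with h
  · obtain ⟨k, rfl⟩ := h
    rw [show (k + k + 1) / 2 = k by omega, show k + k + 1 - k = k + 1 by omega,
      show (k + k) * (k + k + 2) = k * (k + 1) * 4 by ring, Nat.mul_div_cancel _ (by norm_num)]
  · obtain ⟨k, rfl⟩ := Nat.not_even_iff_odd.1 h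
    rw [show (2 * k + 1 + 1) / 2 = k + 1 by omega, show 2 * k + 1 + 1 - (k + 1) = k + 1 by omega,
      show (2 * k + 1 + 1) ^ 2 = (k + 1) * (k + 1) * 4 by ring, Nat.mul_div_cancel _ (by norm_num)]
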